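/- arXiv:2408.15030 — 2 statements merged into one kernel-verified Lean document; each statement's English description precedes it below -/
import Mathlib

section
/- Let N > 1 be a real number, let a < 0 < b be real numbers, and let w : (a,b) → [0,∞) be a continuous integrable function with w(0) > 0 such that x ↦ w(x)^{1/(N-1)} is concave on (a,b), ∫_a^b w(x) dx = 1, and ∫_a^b x·w(x) dx = 0. Then (2(N+1)(N+2)/N²)·∫_a^b x²·w(x) dx ≤ 1/w(0)² ≤ 12·∫_a^b x²·w(x) dx. -/
open MeasureTheory

section

open Set Filter Topology

/-- A function vanishing at `0` with nonnegative derivative on `[0, ∞)` is nonnegative there. -/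
lemma nonneg_of_hasDerivAt_nonneg {f f' : ℝ → ℝ} (hf : ∀ x, HasDerivAt f (f' x) x)
    (h0 : f 0 = 0) (hf' : ∀ x, 0 ≤ x → 0 ≤ f' x) {x : ℝ} (hx : 0 ≤ x) : 0 ≤ f x := by
  have hmono : MonotoneOn f (Ici 0) := by
    refine monotoneOn_of_deriv_nonneg (convex_Ici 0)
      (fun y _ => (hf y).continuousAt.continuousWithinAt)
      (fun y _ => (hf y).differentiableAt.differentiableWithinAt) fun y hy => ?_
    rw [(hf y).deriv]
    rw [interior_Ici] at hy
    exact hf' y (le_of_lt hy)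
  simpa [h0] using hmono self_mem_Ici hx hx

lemma add_cube_div_six_le_sinh {x : ℝ} (hx : 0 ≤ x) : x + x ^ 3 / 6 ≤ Real.sinh x := by
  have h1 : ∀ y : ℝ, 0 ≤ y → 0 ≤ Real.sinh y - y := fun y hy =>
    sub_nonneg.2 (Real.self_le_sinh_iff.2 hy)
  have h2 : ∀ y : ℝ, 0 ≤ y → 0 ≤ Real.cosh y - (1 + y ^ 2 / 2) := fun y hy =>
    nonneg_of_hasDerivAt_nonneg (f' := fun y => Real.sinh y - y)
      (fun y => ((Real.hasDerivAt_cosh y).sub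
        (((hasDerivAt_pow 2 y).div_const 2).const_add 1)).congr_deriv (by norm_num))
      (by norm_num) h1 hy
  have h3 := nonneg_of_hasDerivAt_nonneg (f := fun y => Real.sinh y - (y + y ^ 3 / 6))
      (f' := fun y => Real.cosh y - (1 + y ^ 2 / 2))
      (fun y => ((Real.hasDerivAt_sinh y).sub
        ((hasDerivAt_id y).add ((hasDerivAt_pow 3 y).div_const 6))).congr_deriv
          (by norm_num; ring)) (by norm_num) h2 hx
  linarith

lemma sinh_le_mul_cosh {x : ℝ} (hx : 0 ≤ x) : Real.sinh x ≤ x * Real.cosh x := by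
  have := nonneg_of_hasDerivAt_nonneg (f := fun y => y * Real.cosh y - Real.sinh y)
    (f' := fun y => y * Real.sinh y)
    (fun y => (((hasDerivAt_id y).mul (Real.hasDerivAt_cosh y)).sub
      (Real.hasDerivAt_sinh y)).congr_deriv (by simp))
    (by simp) (fun y hy => mul_nonneg hy (Real.sinh_nonneg_iff.2 hy)) hx
  linarith

lemma four_mul_cosh_le {x : ℝ} (hx : 0 ≤ x) :
    4 * Real.cosh x ≤ x * Real.sinh x + x ^ 2 + 4 := by
  have h2 : ∀ y : ℝ, 0 ≤ y → 0 ≤ y * Real.sinh y - 2 * Real.cosh y + 2 := fun y hy =>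
    nonneg_of_hasDerivAt_nonneg (f' := fun y => y * Real.cosh y - Real.sinh y)
      (fun y => ((((hasDerivAt_id y).mul (Real.hasDerivAt_sinh y)).sub
        ((Real.hasDerivAt_cosh y).const_mul 2)).add_const 2).congr_deriv (by simp; ring))
      (by simp) (fun y hy => sub_nonneg.2 (sinh_le_mul_cosh hy)) hy
  have h1 : ∀ y : ℝ, 0 ≤ y → 0 ≤ y * Real.cosh y - 3 * Real.sinh y + 2 * y := fun y hy =>
    nonneg_of_hasDerivAt_nonneg (f' := fun y => y * Real.sinh y - 2 * Real.cosh y + 2)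
      (fun y => ((((hasDerivAt_id y).mul (Real.hasDerivAt_cosh y)).sub
        ((Real.hasDerivAt_sinh y).const_mul 3)).add
          ((hasDerivAt_id y).const_mul 2)).congr_deriv (by simp; ring))
      (by simp) h2 hy
  have h0 := nonneg_of_hasDerivAt_nonneg
      (f := fun y => y * Real.sinh y - 4 * Real.cosh y + y ^ 2 + 4)
      (f' := fun y => y * Real.cosh y - 3 * Real.sinh y + 2 * y)
      (fun y => (((((hasDerivAt_id y).mul (Real.hasDerivAt_sinh y)).sub
        ((Real.hasDerivAt_cosh y).const_mul 4)).add
          (hasDerivAt_pow 2 y)).add_const 4).congr_deriv (by simp; ring))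
      (by simp) h1 hx
  linarith

/-- The logarithm of `w(0)² Var w`, up to an additive constant, for an exponential density
truncated to a window of half-length `x` around its midpoint and centered at its barycenter. -/
noncomputable def logBarycenterRatio (x : ℝ) : ℝ :=
  2 * (x * Real.cosh x / Real.sinh x) + Real.log (Real.sinh x ^ 2 - x ^ 2)
    - 4 * Real.log (Real.sinh x)

lemma sinh_sq_sub_sq_pos {x : ℝ} (hx : 0 < x) : 0 < Real.sinh x ^ 2 - x ^ 2 := by
  nlinarith [Real.self_lt_sinh_iff.2 hx]

lemma hasDerivAt_logBarycenterRatio {x : ℝ} (hx : 0 < x) :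
    HasDerivAt logBarycenterRatio
      (2 * (((1 * Real.cosh x + x * Real.sinh x) * Real.sinh x - x * Real.cosh x * Real.cosh x)
        / Real.sinh x ^ 2)
        + (2 * Real.sinh x * Real.cosh x - 2 * x) / (Real.sinh x ^ 2 - x ^ 2)
        - 4 * (Real.cosh x / Real.sinh x)) x := by
  have hs := (Real.sinh_pos_iff.2 hx).ne'
  refine (((((hasDerivAt_id x).mul (Real.hasDerivAt_cosh x)).div
    (Real.hasDerivAt_sinh x) hs).const_mul 2).add
    ((((Real.hasDerivAt_sinh x).pow 2).sub (hasDerivAt_pow 2 x)).log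
      (sinh_sq_sub_sq_pos hx).ne')).sub
    (((Real.hasDerivAt_sinh x).log hs).const_mul 4) |>.congr_deriv ?_
  simp

lemma monotoneOn_logBarycenterRatio : MonotoneOn logBarycenterRatio (Ioi 0) := by
  refine monotoneOn_of_deriv_nonneg (convex_Ioi 0)
    (fun y hy => (hasDerivAt_logBarycenterRatio hy).continuousAt.continuousWithinAt)
    (fun y hy => (hasDerivAt_logBarycenterRatio
      (interior_subset hy)).differentiableAt.differentiableWithinAt) fun x hx => ?_
  have hx : 0 < x := interior_subset hx
  rw [(hasDerivAt_logBarycenterRatio hx).deriv]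
  have hs := Real.sinh_pos_iff.2 hx
  have hd := sinh_sq_sub_sq_pos hx
  have hc := Real.cosh_sq x
  have key := four_mul_cosh_le (x := 2 * x) (by linarith)
  rw [Real.sinh_two_mul, Real.cosh_two_mul, hc] at key
  have hnum : 0 ≤ 2 * x * (x * Real.sinh x * Real.cosh x + x ^ 2 - 2 * Real.sinh x ^ 2) :=
    mul_nonneg (by linarith) (by nlinarith)
  have heq : 2 * (((1 * Real.cosh x + x * Real.sinh x) * Real.sinh x
        - x * Real.cosh x * Real.cosh x) / Real.sinh x ^ 2)
        + (2 * Real.sinh x * Real.cosh x - 2 * x) / (Real.sinh x ^ 2 - x ^ 2)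
        - 4 * (Real.cosh x / Real.sinh x) =
      2 * x * (x * Real.sinh x * Real.cosh x + x ^ 2 - 2 * Real.sinh x ^ 2) /
        (Real.sinh x ^ 2 * (Real.sinh x ^ 2 - x ^ 2)) := by
    have hd' := hd.ne'
    field_simp
    linear_combination (-2 * x * (Real.sinh x ^ 2 - x ^ 2)) * hc
  rw [heq]
  positivity

lemma two_sub_log_three_le_logBarycenterRatio {x : ℝ} (hx : 0 < x) :
    2 - Real.log 3 ≤ logBarycenterRatio x := by
  have hlim : Tendsto (fun y => 2 - Real.log 3 - 4 * Real.log (y⁻¹ * Real.sinh y)) (𝓝[>] 0)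
      (𝓝 (2 - Real.log 3 - 4 * Real.log 1)) := by
    have h1 : Tendsto (fun y => y⁻¹ * Real.sinh y) (𝓝[>] 0) (𝓝 1) := by
      have := (Real.hasDerivAt_sinh 0).hasDerivWithinAt (s := Ioi 0)
      rw [hasDerivWithinAt_iff_tendsto_slope' (by simp)] at this
      simpa [slope_fun_def] using this
    exact tendsto_const_nhds.sub ((h1.log one_ne_zero).const_mul 4)
  rw [Real.log_one, mul_zero, sub_zero] at hlim
  refine le_of_tendsto hlim ?_
  filter_upwards [Ioc_mem_nhdsGT hx] with y hy
  refine le_trans ?_ (monotoneOn_logBarycenterRatio hy.1 hx hy.2)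
  have hy0 := hy.1
  have hs := Real.sinh_pos_iff.2 hy0
  have h1 : 1 ≤ y * Real.cosh y / Real.sinh y := (one_le_div hs).2 (sinh_le_mul_cosh hy0.le)
  have h2 : y ^ 4 / 3 ≤ Real.sinh y ^ 2 - y ^ 2 := by
    have h := add_cube_div_six_le_sinh hy0.le
    have := pow_le_pow_left₀ (by positivity) h 2
    nlinarith [pow_pos hy0 6]
  have h3 := Real.log_le_log (by positivity) h2
  rw [Real.log_div (by positivity) (by norm_num), Real.log_pow] at h3
  rw [Real.log_mul (by positivity) hs.ne', Real.log_inv, logBarycenterRatio]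
  push_cast at h3
  linarith

lemma sinh_pow_four_le {x : ℝ} (hx : 0 < x) :
    Real.sinh x ^ 4 ≤ 3 * Real.exp (2 * (x * Real.cosh x / Real.sinh x - 1))
      * (Real.sinh x ^ 2 - x ^ 2) := by
  have hs := Real.sinh_pos_iff.2 hx
  have hd := sinh_sq_sub_sq_pos hx
  have h := two_sub_log_three_le_logBarycenterRatio hx
  rw [logBarycenterRatio] at h
  rw [← Real.log_le_log_iff (by positivity) (by positivity),
    Real.log_mul (by positivity) hd.ne', Real.log_mul (by norm_num) (Real.exp_ne_zero _),
    Real.log_exp, Real.log_pow]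
  push_cast
  linarith

/-- The value at the barycenter, relative to the rate, of a truncated exponential density takes
every value in `(0, e)` as the half-length of the truncation window varies. -/
lemma exists_two_mul_sinh_mul_exp_eq {τ : ℝ} (h0 : 0 < τ) (h1 : τ < Real.exp 1) :
    ∃ h > 0, 2 * Real.sinh h * Real.exp (1 - h * Real.cosh h / Real.sinh h) = τ := by
  set T : ℝ → ℝ := fun h => 2 * Real.sinh h * Real.exp (1 - h * Real.cosh h / Real.sinh h)
  have hcont : ContinuousOn T (Ioi 0) := by
    have : ∀ x ∈ Ioi (0 : ℝ), Real.sinh x ≠ 0 := fun x hx => (Real.sinh_pos_iff.2 hx).ne'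
    refine ContinuousOn.mul (by fun_prop) (Real.continuous_exp.comp_continuousOn
      (continuousOn_const.sub (ContinuousOn.div (by fun_prop) (by fun_prop) this)))
  have hlim : Tendsto T atTop (𝓝 (Real.exp 1)) := by
    have hE : Tendsto (fun h : ℝ => Real.exp (-(2 * h))) atTop (𝓝 0) :=
      Real.tendsto_exp_neg_atTop_nhds_zero.comp (tendsto_id.const_mul_atTop two_pos)
    have hF : Tendsto (fun h : ℝ => 2 * h * Real.exp (-(2 * h))) atTop (𝓝 0) := by
      have := (Real.tendsto_pow_mul_exp_neg_atTop_nhds_zero 1).comp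
        (tendsto_id.const_mul_atTop (two_pos (α := ℝ)))
      simpa [Function.comp_def] using this
    have hG : Tendsto (fun h : ℝ => (1 - Real.exp (-(2 * h))) *
        Real.exp (1 - 2 * h * Real.exp (-(2 * h)) / (1 - Real.exp (-(2 * h))))) atTop
        (𝓝 ((1 - 0) * Real.exp (1 - 0 / (1 - 0)))) :=
      (tendsto_const_nhds.sub hE).mul ((Real.continuous_exp.tendsto _).comp
        (tendsto_const_nhds.sub (hF.div (tendsto_const_nhds.sub hE) (by norm_num))))
    simp only [sub_zero, zero_div, one_mul] at hG
    refine hG.congr' ?_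
    filter_upwards [eventually_gt_atTop 0] with h hh
    have hs := Real.sinh_pos_iff.2 hh
    have e1 : 1 - Real.exp (-(2 * h)) = 2 * Real.sinh h * Real.exp (-h) := by
      rw [Real.sinh_eq, show -(2 * h) = -h + -h by ring, Real.exp_add]
      have : Real.exp h * Real.exp (-h) = 1 := by rw [← Real.exp_add]; simp
      linear_combination -this
    have e2 : Real.exp (-(2 * h)) = Real.exp (-h) * Real.exp (-h) := by
      rw [← Real.exp_add]; ring_nf
    have e3 : 1 - 2 * h * Real.exp (-(2 * h)) / (1 - Real.exp (-(2 * h))) =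
        h + (1 - h * Real.cosh h / Real.sinh h) := by
      rw [e1, e2]
      have := Real.exp_pos (-h)
      have e4 : Real.exp (-h) = Real.cosh h - Real.sinh h := (Real.cosh_sub_sinh h).symm
      field_simp
      rw [e4]; ring
    rw [e3, e1, Real.exp_add]
    have : Real.exp (-h) * Real.exp h = 1 := by rw [← Real.exp_add]; simp
    linear_combination (2 * Real.sinh h * Real.exp (1 - h * Real.cosh h / Real.sinh h)) * this
  obtain ⟨M, hM0, hM⟩ := ((eventually_gt_atTop (0 : ℝ)).and
    (hlim.eventually (lt_mem_nhds h1))).exists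
  have hm0 : 0 < Real.arsinh (τ / 2) := Real.arsinh_pos_iff.2 (by linarith)
  have hm : T (Real.arsinh (τ / 2)) ≤ τ := by
    have hs := Real.sinh_pos_iff.2 hm0
    have h2 : Real.exp (1 - Real.arsinh (τ / 2) * Real.cosh (Real.arsinh (τ / 2))
        / Real.sinh (Real.arsinh (τ / 2))) ≤ 1 := by
      rw [Real.exp_le_one_iff, sub_nonpos]
      exact (one_le_div hs).2 (sinh_le_mul_cosh hm0.le)
    have h3 : 2 * Real.sinh (Real.arsinh (τ / 2)) = τ := by rw [Real.sinh_arsinh]; ring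
    simp only [T, h3]
    exact mul_le_of_le_one_right h0.le h2
  obtain ⟨h, hh, hT⟩ := isPreconnected_Ioi.intermediate_value hm0 hM0 hcont ⟨hm, hM.le⟩
  exact ⟨h, hh, hT⟩

lemma integral_mul_le_intervalIntegral_mul {k g G : ℝ → ℝ} {l r : ℝ} (hlr : l ≤ r)
    (hk : Continuous k) (hG : Continuous G) (hgG : ∀ x ∈ Ioc l r, g x ≤ G x)
    (hkg : Integrable fun x => k x * g x) (hpos : ∀ x ∈ Ioc l r, 0 ≤ k x)
    (hneg : ∀ x ∉ Ioc l r, k x * g x ≤ 0) :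
    ∫ x, k x * g x ≤ ∫ x in l..r, k x * G x := by
  rw [intervalIntegral.integral_of_le hlr, ← integral_indicator measurableSet_Ioc]
  refine integral_mono hkg ?_ fun x => ?_
  · rw [integrable_indicator_iff measurableSet_Ioc]
    exact ((hk.mul hG).integrableOn_Icc).mono_set Ioc_subset_Icc_self
  · by_cases hx : x ∈ Ioc l r
    · rw [indicator_of_mem hx]
      exact mul_le_mul_of_nonneg_left (hgG x hx) (hpos x hx)
    · rw [indicator_of_notMem hx]
      exact hneg x hx

section SecondMoment

variable {g : ℝ → ℝ} {c t : ℝ}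

lemma neg_mul_sub_integral_le_second_moment (hg : ∀ x, 0 ≤ g x)
    (hgc : ∀ x, g x ≤ c * Real.exp (t * x)) (h0 : Integrable g)
    (h1 : Integrable fun x => x * g x) (h2 : Integrable fun x => x ^ 2 * g x)
    (hm : ∫ x, g x = 1) (hb : ∫ x, x * g x = 0) {l r : ℝ} (hlr : l ≤ r) :
    -(l * r) - c * ∫ x in l..r, (x - l) * (r - x) * Real.exp (t * x) ≤ ∫ x, x ^ 2 * g x := by
  have heq : ∀ x, (x - l) * (r - x) * g x = (l + r) * (x * g x) - x ^ 2 * g x - l * r * g x :=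
    fun x => by ring
  have hi1 := h1.const_mul (l + r)
  have hi0 := h0.const_mul (l * r)
  have hi2 : Integrable fun x => (l + r) * (x * g x) - x ^ 2 * g x := hi1.sub h2
  have hint : Integrable fun x => (x - l) * (r - x) * g x := by
    simp_rw [heq]
    exact hi2.sub hi0
  have key := integral_mul_le_intervalIntegral_mul (k := fun x => (x - l) * (r - x))
    (G := fun x => c * Real.exp (t * x)) hlr (by fun_prop) (by fun_prop)
    (fun x _ => hgc x) hint
    (fun x hx => mul_nonneg (by linarith [hx.1]) (by linarith [hx.2]))
    (fun x hx => by
      refine mul_nonpos_of_nonpos_of_nonneg ?_ (hg x)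
      rw [mem_Ioc, not_and_or, not_lt, not_le] at hx
      rcases hx with hx | hx <;> nlinarith)
  have e1 : ∫ x, (x - l) * (r - x) * g x = -(∫ x, x ^ 2 * g x) - l * r := by
    simp_rw [heq]
    rw [integral_sub hi2 hi0, integral_sub hi1 h2, integral_const_mul,
      integral_const_mul, hm, hb]
    ring
  have e2 : ∫ x in l..r, (x - l) * (r - x) * (c * Real.exp (t * x)) =
      c * ∫ x in l..r, (x - l) * (r - x) * Real.exp (t * x) := by
    rw [← intervalIntegral.integral_const_mul]
    congr 1; ext x; ring
  rw [e1, e2] at key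
  linarith

lemma hasDerivAt_exp_mul_const (t x : ℝ) :
    HasDerivAt (fun x => Real.exp (t * x)) (t * Real.exp (t * x)) x :=
  (((hasDerivAt_id x).const_mul t).exp).congr_deriv (by simp; ring)

lemma rate_lt_of_integral_eq_zero {a : ℝ} (hc : 0 < c) (ht : 0 < t) (ha : a < 0)
    (hga : ∀ x ≤ a, g x = 0)
    (hg : ∀ x, 0 ≤ g x) (hgc : ∀ x, g x ≤ c * Real.exp (t * x)) (h0 : Integrable g)
    (h1 : Integrable fun x => x * g x) (hm : ∫ x, g x = 1) (hb : ∫ x, x * g x = 0) :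
    t < c * Real.exp 1 := by
  have heq : ∀ x, (1 / t - x) * g x = 1 / t * g x - x * g x := fun x => by ring
  have hi0 := h0.const_mul (1 / t)
  have htp : 0 < 1 / t := by positivity
  have key := integral_mul_le_intervalIntegral_mul (k := fun x => 1 / t - x)
    (G := fun x => c * Real.exp (t * x)) (ha.trans htp).le (by fun_prop) (by fun_prop)
    (fun x _ => hgc x) (by simp_rw [heq]; exact hi0.sub h1) (fun x hx => by linarith [hx.2])
    (fun x hx => by
      rw [mem_Ioc, not_and_or, not_lt, not_le] at hx
      rcases hx with hx | hx
      · simp [hga x hx]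
      · exact mul_nonpos_of_nonpos_of_nonneg (by linarith) (hg x))
  simp_rw [heq] at key
  rw [integral_sub hi0 h1, integral_const_mul, hm, hb,
    intervalIntegral.integral_eq_sub_of_hasDerivAt
      (f := fun x => c * (Real.exp (t * x) * (2 / t ^ 2 - x / t)))
      (fun x _ => (((hasDerivAt_exp_mul_const t x).mul
        (((hasDerivAt_id x).div_const t).const_sub (2 / t ^ 2))).const_mul c).congr_deriv
          (by simp; field_simp; ring))
      (Continuous.intervalIntegrable (by fun_prop) _ _)] at key
  have hpos : 0 < c * (Real.exp (t * a) * (2 / t ^ 2 - a / t)) := by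
    have : a / t < 0 := div_neg_of_neg_of_pos ha ht
    have : 0 < 2 / t ^ 2 := by positivity
    exact mul_pos hc (mul_pos (Real.exp_pos _) (by linarith))
  have e1 : c * (Real.exp (t * (1 / t)) * (2 / t ^ 2 - 1 / t / t)) = c * Real.exp 1 / t ^ 2 := by
    rw [mul_one_div_cancel ht.ne']; field_simp; ring
  rw [e1] at key
  have : 1 / t < c * Real.exp 1 / t ^ 2 := by linarith
  rw [div_lt_div_iff₀ ht (by positivity)] at this
  nlinarith

lemma integral_sub_mul_sub_mul_exp (ht : t ≠ 0) (l r : ℝ) :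
    ∫ x in l..r, (x - l) * (r - x) * Real.exp (t * x) =
      Real.exp (t * r) * ((r - l) / t ^ 2 - 2 / t ^ 3)
        + Real.exp (t * l) * ((r - l) / t ^ 2 + 2 / t ^ 3) := by
  rw [intervalIntegral.integral_eq_sub_of_hasDerivAt
      (f := fun x => Real.exp (t * x) *
        ((x - l) * (r - x) / t + (2 * x - l - r) / t ^ 2 - 2 / t ^ 3))
      (fun x _ => ((hasDerivAt_exp_mul_const t x).mul
        ((((((hasDerivAt_id x).sub_const l).mul ((hasDerivAt_id x).const_sub r)).div_const t).add
          (((((hasDerivAt_id x).const_mul 2).sub_const l).sub_const r).div_const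
            (t ^ 2))).sub_const (2 / t ^ 3))).congr_deriv
          (by simp; field_simp; ring))
      (Continuous.intervalIntegrable (by fun_prop) _ _)]
  ring

lemma one_div_sq_le_of_le_exp {a : ℝ} (hc : 0 < c) (ht : 0 ≤ t) (ha : a < 0)
    (hga : ∀ x ≤ a, g x = 0)
    (hg : ∀ x, 0 ≤ g x) (hgc : ∀ x, g x ≤ c * Real.exp (t * x)) (h0 : Integrable g)
    (h1 : Integrable fun x => x * g x) (h2 : Integrable fun x => x ^ 2 * g x)
    (hm : ∫ x, g x = 1) (hb : ∫ x, x * g x = 0) :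
    1 / c ^ 2 ≤ 12 * ∫ x, x ^ 2 * g x := by
  rcases ht.eq_or_lt with rfl | ht
  · have hlr : -(1 / (2 * c)) ≤ 1 / (2 * c) := by
      have : 0 < 1 / (2 * c) := by positivity
      linarith
    have key := neg_mul_sub_integral_le_second_moment hg hgc h0 h1 h2 hm hb hlr
    have e : ∫ x in (-(1 / (2 * c)))..(1 / (2 * c)),
        (x - -(1 / (2 * c))) * (1 / (2 * c) - x) * Real.exp (0 * x) = 1 / (6 * c ^ 3) := by
      rw [intervalIntegral.integral_eq_sub_of_hasDerivAt
        (f := fun x => 1 / (2 * c) * (1 / (2 * c)) * x - x ^ 3 / 3)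
        (fun x _ => (((hasDerivAt_id x).const_mul _).sub
          ((hasDerivAt_pow 3 x).div_const 3)).congr_deriv (by simp; ring))
        (Continuous.intervalIntegrable (by fun_prop) _ _)]
      field_simp; ring
    rw [e] at key
    have e2 : 12 * (-(-(1 / (2 * c)) * (1 / (2 * c))) - c * (1 / (6 * c ^ 3))) = 1 / c ^ 2 := by
      field_simp; ring
    linarith
  · have hlt := rate_lt_of_integral_eq_zero hc ht ha hga hg hgc h0 h1 hm hb
    obtain ⟨h, hh, hT⟩ := exists_two_mul_sinh_mul_exp_eq (τ := t / c) (by positivity)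
      (by rw [div_lt_iff₀ hc]; linarith)
    have hs := Real.sinh_pos_iff.2 hh
    obtain ⟨m, hmdef⟩ : ∃ m, m = h * Real.cosh h / Real.sinh h - 1 := ⟨_, rfl⟩
    have hsinh := sinh_pow_four_le hh
    rw [← hmdef] at hsinh
    rw [show 1 - h * Real.cosh h / Real.sinh h = -m by rw [hmdef]; ring] at hT
    have hms : h * Real.cosh h = (m + 1) * Real.sinh h := by rw [hmdef]; field_simp; ring
    have hct : c * (2 * Real.sinh h * Real.exp (-m)) = t := by rw [hT]; field_simp
    have key := neg_mul_sub_integral_le_second_moment hg hgc h0 h1 h2 hm hb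
      (l := (-h - m) / t) (r := (h - m) / t) (by gcongr; linarith)
    rw [integral_sub_mul_sub_mul_exp ht.ne', mul_div_cancel₀ _ ht.ne', mul_div_cancel₀ _ ht.ne',
      show h - m = h + -m by ring, show -h - m = -h + -m by ring, Real.exp_add, Real.exp_add,
      ← Real.cosh_add_sinh h, ← Real.cosh_sub_sinh h] at key
    have e1 : -((-h + -m) / t * ((h + -m) / t)) - c * ((Real.cosh h + Real.sinh h) * Real.exp (-m)
        * (((h + -m) / t - (-h + -m) / t) / t ^ 2 - 2 / t ^ 3)
        + (Real.cosh h - Real.sinh h) * Real.exp (-m)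
        * (((h + -m) / t - (-h + -m) / t) / t ^ 2 + 2 / t ^ 3)) =
        (h ^ 2 - m ^ 2 - 2 * m) / t ^ 2 := by
      have : c * Real.exp (-m) * (h * Real.cosh h - Real.sinh h) * 2 = t * m := by
        rw [hms, ← hct]; ring
      field_simp
      linear_combination (-2) * this
    rw [e1] at key
    have e2 : (h ^ 2 - m ^ 2 - 2 * m) * Real.sinh h ^ 2 = Real.sinh h ^ 2 - h ^ 2 := by
      have := Real.cosh_sq h
      linear_combination (h * Real.cosh h + (m + 1) * Real.sinh h) * hms - h ^ 2 * this
    have e3 : t ^ 2 * Real.exp (2 * m) = 4 * c ^ 2 * Real.sinh h ^ 2 := by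
      have : Real.exp (-m) ^ 2 * Real.exp (2 * m) = 1 := by
        rw [← Real.exp_nat_mul, ← Real.exp_add]; simp
      rw [← hct]
      linear_combination (4 * c ^ 2 * Real.sinh h ^ 2) * this
    have e4 : t ^ 2 ≤ 12 * c ^ 2 * (h ^ 2 - m ^ 2 - 2 * m) := by
      rw [← e2] at hsinh
      have hp : 0 < Real.sinh h ^ 2 := by positivity
      have h5 : Real.sinh h ^ 2 ≤ 3 * Real.exp (2 * m) * (h ^ 2 - m ^ 2 - 2 * m) := by
        refine le_of_mul_le_mul_right ?_ hp
        linarith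
      refine le_of_mul_le_mul_right ?_ (Real.exp_pos (2 * m))
      rw [e3]
      nlinarith [sq_pos_of_pos hc]
    have e5 : 1 / c ^ 2 ≤ 12 * ((h ^ 2 - m ^ 2 - 2 * m) / t ^ 2) := by
      rw [← mul_div_assoc, div_le_div_iff₀ (by positivity) (by positivity)]
      linarith
    linarith

end SecondMoment

/-- If `D` changes sign at most once on `(0, ∞)`, from plus to minus, and has zero first moment,
then its mass is nonnegative and its second moment is nonpositive. -/
lemma moments_of_single_crossing {D : ℝ → ℝ} {Z : ℝ} (hZ : 0 < Z)
    (hD0 : ∀ x ≤ 0, D x = 0) (hDZ : ∀ x, Z ≤ x → D x ≤ 0)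
    (hcross : ∀ x y, 0 < x → x < y → D x < 0 → D y ≤ 0)
    (h0 : Integrable D) (h1 : Integrable fun x => x * D x)
    (h2 : Integrable fun x => x ^ 2 * D x) (hb : ∫ x, x * D x = 0) :
    0 ≤ ∫ x, D x ∧ ∫ x, x ^ 2 * D x ≤ 0 := by
  set S : Set ℝ := insert Z {x | 0 < x ∧ D x < 0}
  have hS0 : ∀ s ∈ S, 0 ≤ s := by
    rintro s (rfl | hs)
    exacts [hZ.le, hs.1.le]
  have hSne : S.Nonempty := ⟨Z, mem_insert _ _⟩
  have hbdd : BddBelow S := ⟨0, hS0⟩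
  obtain ⟨z, hz⟩ : ∃ z, z = sInf S := ⟨_, rfl⟩
  have hz0 : 0 ≤ z := hz ▸ le_csInf hSne hS0
  have hlt : ∀ x, x < z → 0 ≤ D x := by
    intro x hx
    rcases le_or_gt x 0 with h | h
    · exact (hD0 x h).ge
    · by_contra! hneg
      exact absurd (csInf_le hbdd (mem_insert_of_mem Z ⟨h, hneg⟩)) (by rw [← hz]; linarith)
  have hgt : ∀ x, z < x → D x ≤ 0 := by
    intro x hx
    obtain ⟨s, hs, hsx⟩ := exists_lt_of_csInf_lt hSne (hz ▸ hx)
    rcases hs with rfl | hs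
    · exact hDZ x hsx.le
    · exact hcross s x hs.1 hsx hs.2
  have hsign : ∀ x, (x - z) * D x ≤ 0 := by
    intro x
    rcases lt_trichotomy x z with h | rfl | h
    · exact mul_nonpos_of_nonpos_of_nonneg (by linarith) (hlt x h)
    · simp
    · exact mul_nonpos_of_nonneg_of_nonpos (by linarith) (hgt x h)
  constructor
  · rcases hz0.eq_or_lt with rfl | hzpos
    · have hae : (fun x => -(x * D x)) =ᵐ[volume] 0 :=
        (integral_eq_zero_iff_of_nonneg (fun x => by simpa using hsign x) h1.neg).1
          (by simp only [Pi.neg_apply]; rw [integral_neg, hb, neg_zero])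
      refine (integral_eq_zero_of_ae ?_).ge
      filter_upwards [hae] with x hx
      rcases eq_or_ne x 0 with rfl | hx0
      · exact hD0 0 le_rfl
      · simpa [hx0] using hx
    · have hle : ∫ x, x * D x ≤ ∫ x, z * D x :=
        integral_mono h1 (h0.const_mul z) fun x => by
          have := hsign x
          show x * D x ≤ z * D x
          linarith
      rw [hb, integral_const_mul] at hle
      exact nonneg_of_mul_nonneg_right hle hzpos
  · have hle : ∫ x, x ^ 2 * D x ≤ ∫ x, z * (x * D x) :=
      integral_mono h2 (h1.const_mul z) fun x => by
        show x ^ 2 * D x ≤ z * (x * D x)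
        rcases le_or_gt x 0 with h | h
        · simp [hD0 x h]
        · nlinarith [mul_nonpos_of_nonneg_of_nonpos h.le (hsign x)]
    rwa [integral_const_mul, hb, mul_zero] at hle

section Cone

variable {N α : ℝ}

lemma continuous_cone (hN : 1 < N) : Continuous fun x : ℝ => (1 - α * x) ^ (N - 1) :=
  Continuous.rpow_const (by fun_prop) fun _ => Or.inr (by linarith)

lemma hasDerivAt_cone (hN : 1 < N) (x : ℝ) :
    HasDerivAt (fun x : ℝ => (1 - α * x) ^ N) (-α * N * (1 - α * x) ^ (N - 1)) x :=
  ((((hasDerivAt_id x).const_mul α).const_sub 1).rpow_const (Or.inr hN.le)).congr_deriv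
    (by simp)

lemma rpow_eq_mul_rpow_sub_one (hN : 1 < N) {y : ℝ} (hy : 0 ≤ y) : y ^ N = y * y ^ (N - 1) := by
  rw [← Real.rpow_one_add' hy (by linarith)]; congr 1; ring

lemma setIntegral_Ioo_eq_sub {F f : ℝ → ℝ} {l r : ℝ} (hlr : l ≤ r) (hf : Continuous f)
    (hF : ∀ x ∈ Icc l r, HasDerivAt F (f x) x) : ∫ x in Ioo l r, f x = F r - F l := by
  rw [← integral_Ioc_eq_integral_Ioo, ← intervalIntegral.integral_of_le hlr]
  exact intervalIntegral.integral_eq_sub_of_hasDerivAt (by rwa [uIcc_of_le hlr])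
    (hf.intervalIntegrable _ _)

lemma one_sub_mul_nonneg (hα : 0 < α) {x : ℝ} (hx : x ∈ Icc 0 (1 / α)) : 0 ≤ 1 - α * x := by
  have := (le_div_iff₀ hα).1 hx.2
  linarith

lemma integral_cone (hN : 1 < N) (hα : 0 < α) :
    ∫ x in Ioo 0 (1 / α), (1 - α * x) ^ (N - 1) = 1 / (α * N) := by
  have hN0 : N ≠ 0 := by linarith
  rw [setIntegral_Ioo_eq_sub (F := fun x => -((1 - α * x) ^ N / (α * N))) (by positivity)
    (continuous_cone hN) fun x _ =>
      ((hasDerivAt_cone hN x).div_const (α * N)).neg.congr_deriv (by field_simp)]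
  rw [mul_one_div_cancel hα.ne']
  simp [Real.zero_rpow hN0]

lemma integral_mul_cone (hN : 1 < N) (hα : 0 < α) :
    ∫ x in Ioo 0 (1 / α), x * (1 - α * x) ^ (N - 1) = 1 / (α ^ 2 * N * (N + 1)) := by
  have hN0 : N ≠ 0 := by linarith
  have hN1 : N + 1 ≠ 0 := by linarith
  rw [setIntegral_Ioo_eq_sub
    (f := fun x => x * (1 - α * x) ^ (N - 1))
    (F := fun x => -((1 - α * x) ^ N * (1 + N * α * x) / (α ^ 2 * N * (N + 1)))) (by positivity)
    (continuous_id.mul (continuous_cone hN)) fun x hx =>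
      (((hasDerivAt_cone hN x).mul (((hasDerivAt_id x).const_mul (N * α)).const_add 1)).div_const
        (α ^ 2 * N * (N + 1))).neg.congr_deriv (by
          rw [rpow_eq_mul_rpow_sub_one hN (one_sub_mul_nonneg hα hx)]
          simp only [id]
          field_simp
          ring)]
  rw [mul_one_div_cancel hα.ne']
  simp [Real.zero_rpow hN0]

lemma integral_sq_mul_cone (hN : 1 < N) (hα : 0 < α) :
    ∫ x in Ioo 0 (1 / α), x ^ 2 * (1 - α * x) ^ (N - 1) =
      2 / (α ^ 3 * N * (N + 1) * (N + 2)) := by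
  have hN0 : N ≠ 0 := by linarith
  have hN1 : N + 1 ≠ 0 := by linarith
  have hN2 : N + 2 ≠ 0 := by linarith
  rw [setIntegral_Ioo_eq_sub
    (f := fun x => x ^ 2 * (1 - α * x) ^ (N - 1))
    (F := fun x => -((1 - α * x) ^ N * (2 + 2 * N * α * x + N * (N + 1) * α ^ 2 * x ^ 2)
      / (α ^ 3 * N * (N + 1) * (N + 2)))) (by positivity)
    ((continuous_pow 2).mul (continuous_cone hN)) fun x hx =>
      (((hasDerivAt_cone hN x).mul ((((hasDerivAt_id x).const_mul (2 * N * α)).const_add 2).add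
        ((hasDerivAt_pow 2 x).const_mul (N * (N + 1) * α ^ 2)))).div_const
        (α ^ 3 * N * (N + 1) * (N + 2))).neg.congr_deriv (by
          rw [rpow_eq_mul_rpow_sub_one hN (one_sub_mul_nonneg hα hx)]
          simp only [id, Pi.add_apply]
          field_simp
          ring)]
  rw [mul_one_div_cancel hα.ne']
  simp [Real.zero_rpow hN0]

lemma integral_mul_indicator (φ f : ℝ → ℝ) {s : Set ℝ} (hs : MeasurableSet s) :
    ∫ x, φ x * s.indicator f x = ∫ x in s, φ x * f x := by
  rw [← integral_indicator hs]
  congr 1; ext x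
  exact (indicator_mul_right s φ f).symm

lemma integrable_mul_indicator {φ f : ℝ → ℝ} {l r : ℝ} (hφ : Continuous φ)
    (hf : IntegrableOn f (Ioo l r)) : Integrable fun x => φ x * (Ioo l r).indicator f x := by
  have := hf.continuousOn_mul_of_subset hφ.continuousOn isCompact_Icc measurableSet_Ioo
    Ioo_subset_Icc_self
  exact (this.integrable_indicator measurableSet_Ioo).congr
    (ae_of_all _ fun x => indicator_mul_right (Ioo l r) φ f)

lemma ConcaveOn.chord_le {f : ℝ → ℝ} {b x y : ℝ} (hf : ConcaveOn ℝ (Ico 0 b) f) (hx : 0 < x)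
    (hxy : x < y) (hyb : y < b) : (1 - x / y) * f 0 + x / y * f y ≤ f x := by
  have hy := hx.trans hxy
  have h := hf.2 (left_mem_Ico.2 (hy.trans hyb)) (show y ∈ Ico 0 b from ⟨hy.le, hyb⟩)
    (sub_nonneg.2 ((div_le_one hy).2 hxy.le)) (div_nonneg hx.le hy.le) (by ring)
  simpa only [smul_eq_mul, mul_zero, zero_add, div_mul_cancel₀ x hy.ne'] using h

/-- On a half-line, among the densities `w` with `w^{1/(N-1)}` concave and with given value at `0`
and first moment, the cone has the least mass and the greatest second moment. -/
lemma half_line_comparison {b : ℝ} {w : ℝ → ℝ} (hN : 1 < N) (hb : 0 < b) (hα : 0 < α)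
    (hw : ∀ x ∈ Ioo 0 b, 0 ≤ w x) (hw0 : 0 < w 0) (hint : IntegrableOn w (Ioo 0 b))
    (hconc : ConcaveOn ℝ (Ico 0 b) fun x => w x ^ (1 / (N - 1)))
    (hM : ∫ x in Ioo 0 b, x * w x = w 0 / (α ^ 2 * N * (N + 1))) :
    w 0 / (α * N) ≤ ∫ x in Ioo 0 b, w x ∧
      ∫ x in Ioo 0 b, x ^ 2 * w x ≤ 2 * w 0 / (α ^ 3 * N * (N + 1) * (N + 2)) := by
  have hN' : N - 1 ≠ 0 := by linarith
  have hp : 0 < 1 / (N - 1) := one_div_pos.2 (by linarith)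
  set q : ℝ → ℝ := fun x => w 0 * (1 - α * x) ^ (N - 1)
  have hq : IntegrableOn q (Ioo 0 (1 / α)) :=
    ((continuous_const.mul (continuous_cone hN)).integrableOn_Icc).mono_set Ioo_subset_Icc_self
  set W := (Ioo 0 b).indicator w
  set Q := (Ioo 0 (1 / α)).indicator q
  have hW : ∀ x, 0 ≤ W x := indicator_nonneg hw
  have hQ : ∀ x, 0 ≤ Q x := indicator_nonneg fun x hx =>
    mul_nonneg hw0.le (Real.rpow_nonneg (one_sub_mul_nonneg hα (Ioo_subset_Icc_self hx)) _)
  have hcross : ∀ x y, 0 < x → x < y → W x - Q x < 0 → W y - Q y ≤ 0 := by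
    intro x y hx hxy hlt
    by_cases hyb : y < b
    swap
    · have : W y = 0 := indicator_of_notMem (fun h => hyb h.2) _
      linarith [hQ y]
    have hy : 0 < y := hx.trans hxy
    have hxα : x ∈ Ioo 0 (1 / α) := by
      by_contra h
      have : Q x = 0 := indicator_of_notMem h _
      linarith [hW x]
    have hx1 := one_sub_mul_nonneg hα (Ioo_subset_Icc_self hxα)
    have hwx : W x = w x := indicator_of_mem (mem_Ioo.2 ⟨hx, hxy.trans hyb⟩) _
    have hqx : Q x = q x := indicator_of_mem hxα _
    have hroot : ∀ u : ℝ, 0 ≤ u →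
        (w 0 * u ^ (N - 1)) ^ (1 / (N - 1)) = w 0 ^ (1 / (N - 1)) * u := fun u hu => by
      rw [Real.mul_rpow hw0.le (Real.rpow_nonneg hu _), one_div, Real.rpow_rpow_inv hu hN']
    have hfx : w x ^ (1 / (N - 1)) < w 0 ^ (1 / (N - 1)) * (1 - α * x) := by
      rw [← hroot _ hx1]
      exact Real.rpow_lt_rpow (hw x ⟨hx, hxy.trans hyb⟩) (by linarith) hp
    have hchord := hconc.chord_le hx hxy hyb
    have hf0 : 0 < w 0 ^ (1 / (N - 1)) := Real.rpow_pos_of_pos hw0 _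
    have hfy : w y ^ (1 / (N - 1)) < w 0 ^ (1 / (N - 1)) * (1 - α * y) := by
      have h1 : x / y * w y ^ (1 / (N - 1)) <
          x / y * (w 0 ^ (1 / (N - 1)) * (1 - α * y)) := by
        have : x / y * (w 0 ^ (1 / (N - 1)) * (1 - α * y)) =
            w 0 ^ (1 / (N - 1)) * (x / y) - w 0 ^ (1 / (N - 1)) * α * x := by
          field_simp
        rw [this]
        linarith
      exact lt_of_mul_lt_mul_left h1 (by positivity)
    have hwy := hw y ⟨hy, hyb⟩
    have hy1 : 0 < 1 - α * y :=
      pos_of_mul_pos_right ((Real.rpow_nonneg hwy _).trans_lt hfy) hf0.le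
    have hyα : y ∈ Ioo 0 (1 / α) := ⟨hy, by rw [lt_div_iff₀ hα]; linarith⟩
    rw [← hroot _ hy1.le, Real.rpow_lt_rpow_iff hwy
      (mul_nonneg hw0.le (Real.rpow_nonneg hy1.le _)) hp] at hfy
    have e1 : W y = w y := indicator_of_mem (mem_Ioo.2 ⟨hy, hyb⟩) _
    have e2 : Q y = q y := indicator_of_mem hyα _
    rw [e1, e2, sub_nonpos]
    exact hfy.le
  have hiW : ∀ k : ℕ, Integrable fun x => x ^ k * W x := fun k =>
    integrable_mul_indicator (continuous_pow k) hint
  have hiQ : ∀ k : ℕ, Integrable fun x => x ^ k * Q x := fun k =>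
    integrable_mul_indicator (continuous_pow k) hq
  have hiD : ∀ k : ℕ, Integrable fun x => x ^ k * (W x - Q x) := fun k => by
    simp_rw [mul_sub]
    exact (hiW k).sub (hiQ k)
  have hD : ∀ k : ℕ, ∫ x, x ^ k * (W x - Q x) = (∫ x in Ioo 0 b, x ^ k * w x) -
      w 0 * ∫ x in Ioo 0 (1 / α), x ^ k * (1 - α * x) ^ (N - 1) := fun k => by
    simp_rw [mul_sub]
    rw [integral_sub (hiW k) (hiQ k), integral_mul_indicator _ _ measurableSet_Ioo,
      integral_mul_indicator _ _ measurableSet_Ioo, ← integral_const_mul]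
    congr 2; ext x
    simp only [q]; ring
  have hi0 := hiD 0
  have hi1 := hiD 1
  have hD0 := hD 0
  have hD1 := hD 1
  have hD2 := hD 2
  simp only [pow_zero, pow_one, one_mul] at hi0 hi1 hD0 hD1
  rw [integral_cone hN hα] at hD0
  rw [integral_mul_cone hN hα, hM, mul_one_div, sub_self] at hD1
  rw [integral_sq_mul_cone hN hα] at hD2
  obtain ⟨hmass, hsecond⟩ := moments_of_single_crossing (D := fun x => W x - Q x)
    (Z := max b (1 / α)) (lt_max_of_lt_left hb)
    (fun x hx => by
      have e1 : W x = 0 := indicator_of_notMem (fun h => hx.not_gt h.1) _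
      have e2 : Q x = 0 := indicator_of_notMem (fun h => hx.not_gt h.1) _
      simp [e1, e2])
    (fun x hx => by
      have e1 : W x = 0 := indicator_of_notMem
        (fun h => ((le_max_left _ _).trans hx).not_gt h.2) _
      simp [e1, hQ x])
    hcross hi0 hi1 (hiD 2) hD1
  rw [hD0] at hmass
  rw [hD2] at hsecond
  constructor
  · rw [mul_one_div] at hmass
    linarith
  · rw [mul_div_assoc', mul_comm (w 0)] at hsecond
    linarith

end Cone

lemma setIntegral_Ioo_eq_add {φ : ℝ → ℝ} {a b : ℝ} (ha : a < 0) (hb : 0 < b)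
    (hφ : IntegrableOn φ (Ioo a b)) :
    ∫ x in Ioo a b, φ x = (∫ x in Ioo 0 (-a), φ (-x)) + ∫ x in Ioo 0 b, φ x := by
  have hi : IntervalIntegrable φ volume a b := by
    rwa [intervalIntegrable_iff_integrableOn_Ioo_of_le (ha.trans hb).le]
  have h0 : (0 : ℝ) ∈ uIcc a b := by
    rw [uIcc_of_le (ha.trans hb).le]; exact ⟨ha.le, hb.le⟩
  simp only [← integral_Ioc_eq_integral_Ioo]
  rw [← intervalIntegral.integral_of_le (ha.trans hb).le, ← intervalIntegral.integral_of_le hb.le,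
    ← intervalIntegral.integral_of_le (neg_pos.2 ha).le, intervalIntegral.integral_comp_neg,
    neg_neg, neg_zero]
  exact (intervalIntegral.integral_add_adjacent_intervals
    (hi.mono_set (uIcc_subset_uIcc left_mem_uIcc h0))
    (hi.mono_set (uIcc_subset_uIcc h0 right_mem_uIcc))).symm

lemma ConcaveOn.comp_neg_Ioo {f : ℝ → ℝ} {a b : ℝ} (hf : ConcaveOn ℝ (Ioo a b) f) :
    ConcaveOn ℝ (Ioo (-b) (-a)) fun x => f (-x) := by
  refine ⟨convex_Ioo _ _, fun x hx y hy p q hp hq hpq => ?_⟩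
  have h := hf.2 (show -x ∈ Ioo a b from ⟨by linarith [hx.2], by linarith [hx.1]⟩)
    (show -y ∈ Ioo a b from ⟨by linarith [hy.2], by linarith [hy.1]⟩) hp hq hpq
  rwa [smul_neg, smul_neg, ← neg_add] at h

/-- A concave function on an open interval lies below one of its affine tangents at each point. -/
lemma ConcaveOn.exists_le_add_mul_sub {f : ℝ → ℝ} {a b x₀ : ℝ} (hf : ConcaveOn ℝ (Ioo a b) f)
    (hx₀ : x₀ ∈ Ioo a b) : ∃ s, ∀ x ∈ Ioo a b, f x ≤ f x₀ + s * (x - x₀) := by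
  have hg : ConvexOn ℝ (Ioo a b) (-f) := hf.neg
  have hint : x₀ ∈ interior (Ioo a b) := by rwa [interior_Ioo]
  refine ⟨-derivWithin (-f) (Ioi x₀) x₀, fun x hx => ?_⟩
  rcases lt_trichotomy x x₀ with h | rfl | h
  · have := (hg.slope_le_leftDeriv_of_mem_interior hx hint h).trans
      (hg.leftDeriv_le_rightDeriv_of_mem_interior hint)
    rw [slope_def_field, div_le_iff₀ (by linarith)] at this
    simp only [Pi.neg_apply] at this
    linarith
  · simp
  · have := hg.rightDeriv_le_slope_of_mem_interior hint hx h
    rw [slope_def_field, le_div_iff₀ (by linarith)] at this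
    simp only [Pi.neg_apply] at this
    linarith

lemma exists_le_mul_exp {N a b : ℝ} {w : ℝ → ℝ} (hN : 1 < N) (ha : a < 0) (hb : 0 < b)
    (hw : ∀ x ∈ Ioo a b, 0 ≤ w x) (hw0 : 0 < w 0)
    (hconc : ConcaveOn ℝ (Ioo a b) fun x => w x ^ (1 / (N - 1))) :
    ∃ t, ∀ x ∈ Ioo a b, w x ≤ w 0 * Real.exp (t * x) := by
  have hN' : N - 1 ≠ 0 := by linarith
  obtain ⟨s, hs⟩ := hconc.exists_le_add_mul_sub (x₀ := 0) ⟨ha, hb⟩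
  have hf0 : 0 < w 0 ^ (1 / (N - 1)) := Real.rpow_pos_of_pos hw0 _
  refine ⟨s / w 0 ^ (1 / (N - 1)) * (N - 1), fun x hx => ?_⟩
  have h1 : w x ^ (1 / (N - 1)) ≤
      w 0 ^ (1 / (N - 1)) * Real.exp (s / w 0 ^ (1 / (N - 1)) * x) := by
    refine (hs x hx).trans ?_
    have := mul_le_mul_of_nonneg_left (Real.add_one_le_exp (s / w 0 ^ (1 / (N - 1)) * x)) hf0.le
    refine le_trans (le_of_eq ?_) this
    field_simp
    ring
  have h2 := Real.rpow_le_rpow (Real.rpow_nonneg (hw x hx) _) h1 (by linarith : 0 ≤ N - 1)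
  rw [one_div] at h2
  rw [Real.rpow_inv_rpow (hw x hx) hN', Real.mul_rpow (by positivity) (Real.exp_pos _).le,
    Real.rpow_inv_rpow hw0.le hN', ← Real.exp_mul] at h2
  rw [one_div]
  convert h2 using 3
  ring

lemma integral_mul_pos {b : ℝ} {w : ℝ → ℝ} {N : ℝ} (hN : 1 < N) (hb : 0 < b)
    (hw : ∀ x ∈ Ioo 0 b, 0 ≤ w x) (hw0 : 0 < w 0) (hint : IntegrableOn w (Ioo 0 b))
    (hconc : ConcaveOn ℝ (Ico 0 b) fun x => w x ^ (1 / (N - 1))) :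
    0 < ∫ x in Ioo 0 b, x * w x := by
  have hp : 1 / (N - 1) ≠ 0 := (one_div_pos.2 (by linarith)).ne'
  have hpos : ∀ x ∈ Ioo 0 b, 0 < w x := by
    intro x hx
    obtain ⟨y, hxy, hyb⟩ := exists_between hx.2
    have hy : 0 < y := hx.1.trans hxy
    have hchord := hconc.chord_le hx.1 hxy hyb
    have h1 : 0 < (1 - x / y) * w 0 ^ (1 / (N - 1)) :=
      mul_pos (by rw [sub_pos, div_lt_one hy]; exact hxy) (Real.rpow_pos_of_pos hw0 _)
    have h2 : 0 ≤ x / y * w y ^ (1 / (N - 1)) :=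
      mul_nonneg (div_nonneg hx.1.le hy.le) (Real.rpow_nonneg (hw y ⟨hy, hyb⟩) _)
    refine (hw x hx).lt_of_ne fun h0 => ?_
    rw [← h0, Real.zero_rpow hp] at hchord
    linarith
  rw [← integral_Ioc_eq_integral_Ioo, ← intervalIntegral.integral_of_le hb.le]
  refine intervalIntegral.intervalIntegral_pos_of_pos_on ?_
    (fun x hx => mul_pos hx.1 (hpos x hx)) hb
  rw [intervalIntegrable_iff_integrableOn_Ioo_of_le hb.le]
  exact hint.continuousOn_mul_of_subset continuousOn_id isCompact_Icc measurableSet_Ioo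
    Ioo_subset_Icc_self

section Main

variable {N a b : ℝ} {w : ℝ → ℝ}

lemma second_moment_le (hN : 1 < N) (ha : a < 0) (hb : 0 < b)
    (hw : ∀ x ∈ Ioo a b, 0 ≤ w x) (hw0 : 0 < w 0) (hint : IntegrableOn w (Ioo a b))
    (hconc : ConcaveOn ℝ (Ioo a b) fun x => w x ^ (1 / (N - 1)))
    (hmass : ∫ x in Ioo a b, w x = 1) (hbar : ∫ x in Ioo a b, x * w x = 0) :
    2 * (N + 1) * (N + 2) / N ^ 2 * ∫ x in Ioo a b, x ^ 2 * w x ≤ 1 / w 0 ^ 2 := by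
  have hmul : ∀ φ : ℝ → ℝ, Continuous φ → IntegrableOn (fun x => φ x * w x) (Ioo a b) :=
    fun φ hφ => hint.continuousOn_mul_of_subset hφ.continuousOn isCompact_Icc measurableSet_Ioo
      Ioo_subset_Icc_self
  have ha' : 0 < -a := neg_pos.2 ha
  have hsubR : Ioo 0 b ⊆ Ioo a b := Ioo_subset_Ioo_left ha.le
  have hsubL : Ioo 0 (-a) ⊆ Ioo (-b) (-a) := Ioo_subset_Ioo_left (by linarith)
  have hintR := hint.mono_set hsubR
  have hintL : IntegrableOn (fun x => w (-x)) (Ioo 0 (-a)) := by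
    have : IntegrableOn (fun x => w (-x)) (Ioo (-b) (-a)) := by
      have h := (integrable_indicator_iff measurableSet_Ioo).2 hint |>.comp_neg
      rw [← integrable_indicator_iff measurableSet_Ioo]
      refine h.congr (ae_of_all _ fun x => ?_)
      simp only [indicator, mem_Ioo, neg_lt, lt_neg, and_comm]
    exact this.mono_set hsubL
  have hwL : ∀ x ∈ Ioo 0 (-a), 0 ≤ w (-x) := fun x hx =>
    hw _ ⟨by linarith [hx.2], by linarith [hx.1]⟩
  have hwR : ∀ x ∈ Ioo 0 b, 0 ≤ w x := fun x hx => hw x (hsubR hx)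
  have hconcR : ConcaveOn ℝ (Ico 0 b) fun x => w x ^ (1 / (N - 1)) :=
    hconc.subset (fun x hx => ⟨ha.trans_le hx.1, hx.2⟩) (convex_Ico 0 b)
  have hconcL : ConcaveOn ℝ (Ico 0 (-a)) fun x => w (-x) ^ (1 / (N - 1)) :=
    hconc.comp_neg_Ioo.subset (fun x hx => ⟨(neg_neg_of_pos hb).trans_le hx.1, hx.2⟩)
      (convex_Ico 0 (-a))
  have hwL0 : 0 < w (-0) := by rwa [neg_zero]
  obtain ⟨M, hMdef⟩ : ∃ M, M = ∫ x in Ioo 0 b, x * w x := ⟨_, rfl⟩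
  have hM : 0 < M := hMdef ▸ integral_mul_pos hN hb hwR hw0 hintR hconcR
  have hML : ∫ x in Ioo 0 (-a), x * w (-x) = M := by
    have := setIntegral_Ioo_eq_add ha hb (hmul (fun x => x) continuous_id)
    simp only [neg_mul, integral_neg] at this
    linarith
  have hmass' := setIntegral_Ioo_eq_add ha hb hint
  have hsecond := setIntegral_Ioo_eq_add ha hb (hmul (fun x => x ^ 2) (continuous_pow 2))
  simp only [neg_sq] at hsecond
  obtain ⟨α, hα, hαM⟩ : ∃ α, 0 < α ∧ M = w 0 / (α ^ 2 * N * (N + 1)) := by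
    have hpos : 0 < w 0 / (M * N * (N + 1)) := by positivity
    refine ⟨√(w 0 / (M * N * (N + 1))), Real.sqrt_pos.2 hpos, ?_⟩
    rw [Real.sq_sqrt hpos.le]
    field_simp
  obtain ⟨hR0, hR2⟩ := half_line_comparison hN hb hα hwR hw0 hintR hconcR
    (hMdef.symm.trans hαM)
  obtain ⟨hL0, hL2⟩ := half_line_comparison (w := fun x => w (-x)) hN ha' hα hwL hwL0 hintL hconcL
    (by rw [neg_zero]; exact hML.trans hαM)
  simp only [neg_zero] at hL0 hL2
  set y := 2 * (w 0 / (α * N)) with hy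
  have hy0 : 0 ≤ y := by positivity
  have hy1 : y ≤ 1 := by linarith
  have hV : ∫ x in Ioo a b, x ^ 2 * w x ≤ 4 * w 0 / (α ^ 3 * N * (N + 1) * (N + 2)) := by
    rw [hsecond]
    refine (add_le_add hL2 hR2).trans (le_of_eq ?_)
    ring
  calc 2 * (N + 1) * (N + 2) / N ^ 2 * ∫ x in Ioo a b, x ^ 2 * w x
      ≤ 2 * (N + 1) * (N + 2) / N ^ 2 * (4 * w 0 / (α ^ 3 * N * (N + 1) * (N + 2))) := by
        gcongr
    _ = y ^ 3 / w 0 ^ 2 := by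
        rw [hy]; field_simp; ring
    _ ≤ 1 / w 0 ^ 2 := by
        gcongr
        exact pow_le_one₀ hy0 hy1

lemma one_div_sq_le_second_moment (hN : 1 < N) (ha : a < 0) (hb : 0 < b)
    (hw : ∀ x ∈ Ioo a b, 0 ≤ w x) (hw0 : 0 < w 0) (hint : IntegrableOn w (Ioo a b))
    (hconc : ConcaveOn ℝ (Ioo a b) fun x => w x ^ (1 / (N - 1)))
    (hmass : ∫ x in Ioo a b, w x = 1) (hbar : ∫ x in Ioo a b, x * w x = 0) :
    1 / w 0 ^ 2 ≤ 12 * ∫ x in Ioo a b, x ^ 2 * w x := by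
  obtain ⟨t, ht⟩ := exists_le_mul_exp hN ha hb hw hw0 hconc
  set g := (Ioo a b).indicator w
  have hg : ∀ x, 0 ≤ g x := indicator_nonneg hw
  have hgt : ∀ x, g x ≤ w 0 * Real.exp (t * x) := fun x => by
    by_cases hx : x ∈ Ioo a b
    · exact (indicator_of_mem hx w).trans_le (ht x hx)
    · exact (indicator_of_notMem hx w).trans_le (by positivity)
  have hi0 : Integrable g := (integrable_indicator_iff measurableSet_Ioo).2 hint
  have hi1 : Integrable fun x => x * g x := integrable_mul_indicator continuous_id hint
  have hi2 : Integrable fun x => x ^ 2 * g x := integrable_mul_indicator (continuous_pow 2) hint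
  have hm : ∫ x, g x = 1 := (integral_indicator measurableSet_Ioo).trans hmass
  have hb1 : ∫ x, x * g x = 0 := (integral_mul_indicator _ _ measurableSet_Ioo).trans hbar
  rw [← integral_mul_indicator _ _ measurableSet_Ioo]
  rcases le_total 0 t with h | h
  · exact one_div_sq_le_of_le_exp hw0 h ha
      (fun x hx => indicator_of_notMem (fun h => hx.not_gt h.1) _) hg hgt hi0 hi1 hi2 hm hb1
  · have hj1 : Integrable fun x => x * g (-x) := by simpa using hi1.comp_neg.neg
    have hj2 : Integrable fun x => x ^ 2 * g (-x) := by simpa using hi2.comp_neg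
    have e1 : ∫ x, x * g (-x) = -∫ x, x * g x := by
      rw [← integral_neg, ← integral_neg_eq_self fun x => x * g (-x)]
      simp
    have e2 : ∫ x, x ^ 2 * g (-x) = ∫ x, x ^ 2 * g x := by
      rw [← integral_neg_eq_self fun x => x ^ 2 * g (-x)]
      simp
    rw [← e2]
    refine one_div_sq_le_of_le_exp (t := -t) (a := -b) hw0 (by linarith) (by linarith)
      (fun x hx => indicator_of_notMem (fun h => ?_) _) (fun x => hg (-x))
      (fun x => by simpa using hgt (-x)) hi0.comp_neg hj1 hj2
      ((integral_neg_eq_self g volume).trans hm) (by rw [e1, hb1, neg_zero])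
    linarith [h.2]

end Main

end

/-- Two-sided bound relating the value at the barycenter of a centered probability
density `w` on `(a,b)` with `w^{1/(N-1)}` concave (`N ∈ (1,∞)`) to its second
moment:
`(2(N+1)(N+2)/N²)·∫ x² w ≤ 1/w(0)² ≤ 12·∫ x² w`. -/
theorem density_at_barycenter_bound (N a b : ℝ) (w : ℝ → ℝ)
    (hN : 1 < N) (ha : a < 0) (hb : 0 < b)
    (hw : ∀ x ∈ Set.Ioo a b, 0 ≤ w x)
    (hcont : ContinuousOn w (Set.Ioo a b)) (hw0 : 0 < w 0)
    (hint : IntegrableOn w (Set.Ioo a b))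
    (hconc : ConcaveOn ℝ (Set.Ioo a b) (fun x => w x ^ (1 / (N - 1))))
    (hmass : ∫ x in Set.Ioo a b, w x = 1)
    (hbar : ∫ x in Set.Ioo a b, x * w x = 0) :
    2 * (N + 1) * (N + 2) / N ^ 2 * ∫ x in Set.Ioo a b, x ^ 2 * w x ≤ 1 / w 0 ^ 2 ∧
      1 / w 0 ^ 2 ≤ 12 * ∫ x in Set.Ioo a b, x ^ 2 * w x := by
  exact ⟨second_moment_le hN ha hb hw hw0 hint hconc hmass hbar,
    one_div_sq_le_second_moment hN ha hb hw hw0 hint hconc hmass hbar⟩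
end

section
/- Let N > 1, let a < 0 < b be real numbers, and let w : (a,b) → [0,∞) be an integrable function with ∫_a^b w(x) dx = 1 and ∫_a^b x·w(x) dx = 0. Define R(x) := ∫_a^x w(s) ds and suppose R(0) > 0. If there exists c > 0 such that R(x) ≤ R(0)·(1 + (c/N)·x)^N for all x ∈ (a,b), then R(0) ≥ (N/(N+1))^N. -/
open MeasureTheory

/-- The integral of a primitive, by integration by parts. -/
theorem integral_primitive_eq {a b : ℝ} {w : ℝ → ℝ} (h : IntervalIntegrable w volume a b) :
    ∫ x in a..b, (∫ s in a..x, w s) = b * (∫ x in a..b, w x) - ∫ x in a..b, x * w x := by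
  have hac := h.absolutelyContinuousOnInterval_intervalIntegral Set.left_mem_uIcc
  have hid : AbsolutelyContinuousOnInterval (fun x : ℝ => x) a b :=
    (LipschitzWith.id.lipschitzOnWith (s := Set.uIcc a b)).absolutelyContinuousOnInterval
  have key := hac.integral_mul_deriv_eq_deriv_mul hid
  have hd : ∫ x in a..b, deriv (fun y => ∫ s in a..y, w s) x * x = ∫ x in a..b, x * w x := by
    refine intervalIntegral.integral_congr_ae ?_
    filter_upwards [h.ae_hasDerivAt_integral] with x hx hxm
    rw [(hx (Set.uIoc_subset_uIcc hxm) a Set.left_mem_uIcc).deriv, mul_comm]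
  rw [hd] at key
  simpa [mul_comm b] using key

theorem integral_one_add_mul_rpow {k N m u : ℝ} (hk : k ≠ 0) (hN : -1 < N) :
    ∫ x in m..u, (1 + k * x) ^ N =
      ((1 + k * u) ^ (N + 1) - (1 + k * m) ^ (N + 1)) / (k * (N + 1)) := by
  have h := intervalIntegral.integral_comp_mul_add (a := m) (b := u) (fun y : ℝ => y ^ N) hk 1
  rw [integral_rpow (Or.inl hN)] at h
  simp only [add_comm (1 : ℝ)]
  rw [h, smul_eq_mul]
  have : N + 1 ≠ 0 := by linarith
  field_simp

/-- A function bounded by the power profile `p (1 + k x) ^ N`, by `1`, and vanishing before `m`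
has integral at most the one of its bounds. -/
theorem integral_le_of_le_rpow {F : ℝ → ℝ} {a b m u p k N : ℝ} (hk : 0 < k) (hN : 0 < N)
    (hp : 0 ≤ p) (ham : a ≤ m) (hmu : m ≤ u) (hub : u ≤ b) (hm : 0 ≤ 1 + k * m)
    (hF : ContinuousOn F (Set.Icc a b)) (h0 : ∀ x ∈ Set.Icc a m, F x ≤ 0)
    (h1 : ∀ x ∈ Set.Icc a b, F x ≤ 1)
    (hb : ∀ x ∈ Set.Icc a b, F x ≤ p * (1 + k * x) ^ N) :
    ∫ x in a..b, F x ≤ p * (1 + k * u) ^ (N + 1) / (k * (N + 1)) + (b - u) := by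
  have hi : ∀ c d, a ≤ c → c ≤ d → d ≤ b → IntervalIntegrable F volume c d :=
    fun c d hc hcd hd =>
      (hF.mono (Set.Icc_subset_Icc hc hd)).intervalIntegrable_of_Icc hcd
  have e1 : ∫ x in a..m, F x ≤ 0 := by
    have := intervalIntegral.integral_mono_on ham (hi a m le_rfl ham (hmu.trans hub))
      (intervalIntegrable_const (c := (0 : ℝ))) h0
    simpa using this
  have e3 : ∫ x in u..b, F x ≤ b - u := by
    have := intervalIntegral.integral_mono_on hub (hi u b (ham.trans hmu) hub le_rfl)
      (intervalIntegrable_const (c := (1 : ℝ)))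
      (fun x hx => h1 x ⟨(ham.trans hmu).trans hx.1, hx.2⟩)
    simpa using this
  have e2 : ∫ x in m..u, F x ≤ p * (1 + k * u) ^ (N + 1) / (k * (N + 1)) := by
    have hcont : Continuous fun x : ℝ => p * (1 + k * x) ^ N :=
      continuous_const.mul ((by fun_prop : Continuous fun x : ℝ => 1 + k * x).rpow_const
        fun _ => Or.inr hN.le)
    have := intervalIntegral.integral_mono_on hmu (hi m u ham hmu hub)
      (hcont.intervalIntegrable m u) (fun x hx => hb x ⟨ham.trans hx.1, hx.2.trans hub⟩)
    rw [intervalIntegral.integral_const_mul,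
      integral_one_add_mul_rpow hk.ne' (by linarith), ← mul_div_assoc] at this
    refine this.trans ?_
    have := Real.rpow_nonneg hm (N + 1)
    gcongr
    linarith
  rw [← intervalIntegral.integral_add_adjacent_intervals (hi a m le_rfl ham (hmu.trans hub))
      (hi m b ham (hmu.trans hub) le_rfl),
    ← intervalIntegral.integral_add_adjacent_intervals (hi m u ham hmu hub)
      (hi u b (ham.trans hmu) hub le_rfl)]
  linarith

/-- Generalized one-dimensional Grünbaum inequality: if the cumulative distribution
function `R` of a centered probability density `w` on `(a,b)` satisfies the model
growth bound `R(x) ≤ R(0)·(1 + (c/N)x)^N`, then `R(0) ≥ (N/(N+1))^N`. -/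
theorem grunbaum_of_growth_bound (N a b : ℝ) (w : ℝ → ℝ)
    (hN : 1 < N) (ha : a < 0) (hb : 0 < b)
    (hw : ∀ x ∈ Set.Ioo a b, 0 ≤ w x)
    (hint : IntegrableOn w (Set.Ioo a b))
    (hmass : ∫ x in Set.Ioo a b, w x = 1)
    (hbar : ∫ x in Set.Ioo a b, x * w x = 0)
    (hR0 : 0 < ∫ s in Set.Ioo a 0, w s)
    (c : ℝ) (hc : 0 < c)
    (hbound : ∀ x ∈ Set.Ioo a b,
      (∫ s in Set.Ioo a x, w s) ≤ (∫ s in Set.Ioo a 0, w s) * (1 + (c / N) * x) ^ N) :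
    (N / (N + 1)) ^ N ≤ ∫ s in Set.Ioo a 0, w s := by
  have hab : a ≤ b := by linarith
  have hIoo : ∀ (f : ℝ → ℝ) (x : ℝ), a ≤ x → ∫ s in Set.Ioo a x, f s = ∫ s in a..x, f s :=
    fun f x hx => by
      rw [intervalIntegral.integral_of_le hx, integral_Ioc_eq_integral_Ioo]
  have hwi : IntervalIntegrable w volume a b :=
    (intervalIntegrable_iff_integrableOn_Ioo_of_le hab).2 hint
  rw [hIoo _ _ hab] at hmass hbar
  rw [hIoo _ _ ha.le] at hR0 hbound ⊢
  set F : ℝ → ℝ := fun x => ∫ s in a..x, w s with hFdef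
  set p := ∫ s in a..0, w s with hp
  set k := c / N with hk_def
  have hk : 0 < k := by positivity
  have hN0 : 0 < N := by linarith
  have hF : ContinuousOn F (Set.Icc a b) := by
    have := intervalIntegral.continuousOn_primitive_interval' hwi Set.left_mem_uIcc
    rwa [Set.uIcc_of_le hab] at this
  have hmono : ∀ x y, a ≤ x → x ≤ y → y ≤ b → F x ≤ F y := fun x y hx hxy hy => by
    have hsub : ∀ c d, a ≤ c → c ≤ d → d ≤ b → IntervalIntegrable w volume c d :=
      fun c d hc hcd hd => hwi.mono_set (by
        rw [Set.uIcc_of_le hab, Set.uIcc_of_le hcd]; exact Set.Icc_subset_Icc hc hd)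
    have h := intervalIntegral.integral_add_adjacent_intervals
      (hsub a x le_rfl hx (hxy.trans hy)) (hsub x y hx hxy hy)
    have h' : 0 ≤ ∫ s in x..y, w s := by
      rw [intervalIntegral.integral_of_le hxy, integral_Ioc_eq_integral_Ioo]
      exact setIntegral_nonneg measurableSet_Ioo
        fun s hs => hw s ⟨hx.trans_lt hs.1, hs.2.trans_le hy⟩
    simp only [hFdef]
    linarith
  have hFb : F b = 1 := hmass
  have hFa : F a = 0 := intervalIntegral.integral_same
  have hmodel : Continuous fun x : ℝ => p * (1 + k * x) ^ N :=
    continuous_const.mul ((by fun_prop : Continuous fun x : ℝ => 1 + k * x).rpow_const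
      fun _ => Or.inr hN0.le)
  have hle : ∀ x ∈ Set.Icc a b, F x ≤ p * (1 + k * x) ^ N := by
    have hcl : closure (Set.Ioo a b) = Set.Icc a b := closure_Ioo (by linarith)
    intro x hx
    refine le_on_closure (s := Set.Ioo a b) (f := F) (fun y hy => ?_) (hcl ▸ hF)
      hmodel.continuousOn (hcl ▸ hx)
    simpa only [hIoo w y hy.1.le] using hbound y hy
  have hp1 : p ≤ 1 := hFb ▸ hmono 0 b ha.le hb.le le_rfl
  set t := p ^ (-N⁻¹) with ht
  have ht0 : 0 < t := Real.rpow_pos_of_pos hR0 _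
  have ht1 : 1 ≤ t := Real.one_le_rpow_of_pos_of_le_one_of_nonpos hR0 hp1 (by
    have := inv_pos.2 hN0
    linarith)
  have htN : t ^ N = p⁻¹ := by
    rw [ht, ← Real.rpow_mul hR0.le, neg_mul, inv_mul_cancel₀ hN0.ne', Real.rpow_neg_one]
  have hut : 1 + k * ((t - 1) / k) = t := by field_simp; ring
  have hub : (t - 1) / k ≤ b := by
    have h1 := hle b ⟨hab, le_rfl⟩
    rw [hFb] at h1
    have h2 : t ^ N ≤ (1 + k * b) ^ N := by
      rw [htN, inv_le_iff_one_le_mul₀ hR0, mul_comm]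
      exact h1
    have h3 := (Real.rpow_le_rpow_iff ht0.le (by positivity) hN0).1 h2
    rw [div_le_iff₀ hk]
    linarith
  have hneg : -(1 / k) < 0 := by
    have : 0 < 1 / k := by positivity
    linarith
  have hzero : 1 + k * -(1 / k) = 0 := by field_simp; ring
  have h0 : ∀ x ∈ Set.Icc a (max a (-(1 / k))), F x ≤ 0 := fun x hx => by
    rcases le_total a (-(1 / k)) with h | h
    · rw [max_eq_right h] at hx
      refine (hmono x _ hx.1 hx.2 (by linarith)).trans ((hle _ ⟨h, by linarith⟩).trans ?_)
      rw [hzero, Real.zero_rpow hN0.ne', mul_zero]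
    · rw [max_eq_left h] at hx
      rw [le_antisymm hx.2 hx.1, hFa]
  have hu0 : 0 ≤ (t - 1) / k := div_nonneg (by linarith) hk.le
  have hint_le := integral_le_of_le_rpow hk hN0 hR0.le (le_max_left a (-(1 / k)))
    ((max_le ha.le hneg.le).trans hu0) hub
    (hzero ▸ by gcongr; exact le_max_right _ _) hF h0
    (fun x hx => hFb ▸ hmono x b hx.1 hx.2 le_rfl) hle
  have hprim : ∫ x in a..b, F x = b := by
    rw [integral_primitive_eq hwi, hmass, hbar]; ring
  rw [hprim, hut, Real.rpow_add_one ht0.ne', htN, ← mul_assoc, mul_inv_cancel₀ hR0.ne',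
    one_mul] at hint_le
  have hfin : t ≤ (N + 1) / N := by
    have h : (t - 1) / k ≤ t / (k * (N + 1)) := by linarith
    rw [div_le_div_iff₀ hk (by positivity)] at h
    have h' : (t - 1) * (N + 1) ≤ t := by
      refine le_of_mul_le_mul_right ?_ hk
      linarith
    rw [le_div_iff₀ hN0]
    linarith
  have hpow : p⁻¹ ≤ ((N + 1) / N) ^ N := htN ▸ Real.rpow_le_rpow ht0.le hfin hN0.le
  rw [← inv_div, Real.inv_rpow (by positivity)]
  exact inv_le_of_inv_le₀ hR0 hpow
end
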